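/- arXiv:2309.15355 — 2 statements merged into one kernel-verified Lean document; each statement's English description precedes it below -/
import Mathlib

section
/- Let p ≥ 2, n ≥ 1, let β ∈ ℝ^p satisfy |β_1| ≥ |β_2| ≥ … ≥ |β_p|, let σ > 0, λ = √(2·log p/n), let s₀ be the essential sparsity of β, T₀ = {1,…,s₀}, A₀ = {j : |β_j| > λσ}, and a₀ = |A₀|. Let β_init ∈ ℝ^p, h = β_init − β_{T₀}, t₀ > 0, I = {j : |β_init,j| ≥ t₀}, 𝒟 = {1,…,p} \ I, and 𝒟₁₁ = 𝒟 ∩ A₀. Then ‖β_𝒟‖₂² ≤ (s₀ − a₀)·λ²σ² + (t₀·√a₀ + ‖h_{𝒟₁₁}‖₂)². Moreover, if A₀ ≠ ∅ and t₀ < β_min,A₀ := min_{j∈A₀}|β_j|, then ‖β_𝒟‖₂² ≤ (s₀ − a₀)·λ²σ² + ‖h_{𝒟₁₁}‖₂²·(β_min,A₀/(β_min,A₀ − t₀))². -/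
open Finset Matrix Real
open scoped BigOperators Classical

noncomputable section

namespace ThreshLasso

/-- ℓ₂ norm of a finite real vector. -/
def l2 {m : ℕ} (v : Fin m → ℝ) : ℝ := Real.sqrt (∑ i, (v i) ^ 2)

/-- ℓ₁ norm of a finite real vector. -/
def l1 {m : ℕ} (v : Fin m → ℝ) : ℝ := ∑ i, |v i|

/-- Restriction of a vector to a set of coordinates (zero outside). -/
def restr {p : ℕ} (v : Fin p → ℝ) (T : Finset (Fin p)) : Fin p → ℝ :=
  fun j => if j ∈ T then v j else 0

/-- Support of a vector, as a `Finset`. -/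
def supp {p : ℕ} (v : Fin p → ℝ) : Finset (Fin p) :=
  Finset.univ.filter fun j => v j ≠ 0

/-- `L` is the minimal `m`-sparse eigenvalue `Λ_min(m)` of `X`:
the least value of `‖Xv‖₂²/(n‖v‖₂²)` over nonzero `v` with at most `m`
nonzero coordinates. -/
def IsLambdaMin {n p : ℕ} (X : Matrix (Fin n) (Fin p) ℝ) (m : ℕ) (L : ℝ) : Prop :=
  IsLeast {r : ℝ | ∃ v : Fin p → ℝ, v ≠ 0 ∧ (supp v).card ≤ m ∧
    r = (l2 (X.mulVec v)) ^ 2 / (n * (l2 v) ^ 2)} L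

/-- `L` is the maximal `m`-sparse eigenvalue `Λ_max(m)` of `X`
(with the convention `Λ_max(0) = 0`, implemented by inserting `0` in the set,
which does not change the maximum when `m ≥ 1`). -/
def IsLambdaMax {n p : ℕ} (X : Matrix (Fin n) (Fin p) ℝ) (m : ℕ) (L : ℝ) : Prop :=
  IsGreatest (insert (0 : ℝ) {r : ℝ | ∃ v : Fin p → ℝ, v ≠ 0 ∧ (supp v).card ≤ m ∧
    r = (l2 (X.mulVec v)) ^ 2 / (n * (l2 v) ^ 2)}) L

/-- `θ` is the restricted orthogonality constant `θ_{m,m'}` of `X`: the smallest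
nonnegative `t` such that `|⟨Xu, Xu'⟩|/n ≤ t‖u‖₂‖u'‖₂` for all `u, u'` supported
on disjoint sets of cardinality at most `m`, `m'` respectively. -/
def IsTheta {n p : ℕ} (X : Matrix (Fin n) (Fin p) ℝ) (m m' : ℕ) (θ : ℝ) : Prop :=
  IsLeast {t : ℝ | 0 ≤ t ∧ ∀ (u u' : Fin p → ℝ) (T T' : Finset (Fin p)),
    Disjoint T T' → T.card ≤ m → T'.card ≤ m' →
    (∀ j, j ∉ T → u j = 0) → (∀ j, j ∉ T' → u' j = 0) →
    |∑ i, (X.mulVec u i) * (X.mulVec u' i)| / n ≤ t * (l2 u * l2 u')} θ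

/-- Restricted eigenvalue condition `RE(s₀, k₀, X)` with constant `K`. -/
def RECond {n p : ℕ} (X : Matrix (Fin n) (Fin p) ℝ) (s₀ : ℕ) (k₀ K : ℝ) : Prop :=
  0 < K ∧ ∀ (v : Fin p → ℝ) (J : Finset (Fin p)), J.card ≤ s₀ →
    l1 (restr v Jᶜ) ≤ k₀ * l1 (restr v J) →
    l2 (restr v J) / K ≤ l2 (X.mulVec v) / Real.sqrt n

/-- `s₀` is the essential sparsity of `β`: the smallest nonnegative integer `m`
with `∑ᵢ min(βᵢ², λ²σ²) ≤ m λ²σ²`. -/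
def EssSparsity {p : ℕ} (β : Fin p → ℝ) (lam σ : ℝ) (s₀ : ℕ) : Prop :=
  IsLeast {m : ℕ | ∑ i, min ((β i) ^ 2) (lam ^ 2 * σ ^ 2) ≤ (m : ℝ) * (lam ^ 2 * σ ^ 2)} s₀

/-- `T₀` is a set of indices of the `s₀` largest coordinates of `β` in absolute value. -/
def TopSet {p : ℕ} (β : Fin p → ℝ) (s₀ : ℕ) (T₀ : Finset (Fin p)) : Prop :=
  T₀.card = s₀ ∧ ∀ i ∈ T₀, ∀ j, j ∉ T₀ → |β j| ≤ |β i|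

/-- `T₁` is a set of indices of the `s₀` largest coordinates of `h` in absolute
value outside `T₀`. -/
def TopSetOutside {p : ℕ} (h : Fin p → ℝ) (s₀ : ℕ) (T₀ T₁ : Finset (Fin p)) : Prop :=
  T₁.card = s₀ ∧ Disjoint T₀ T₁ ∧
    ∀ i ∈ T₁, ∀ j, j ∉ T₀ → j ∉ T₁ → |h j| ≤ |h i|

/-- `b` is a Lasso minimizer with penalty `lamn` for data `(X, Y)`. -/
def IsLassoSol {n p : ℕ} (X : Matrix (Fin n) (Fin p) ℝ) (Y : Fin n → ℝ)
    (lamn : ℝ) (b : Fin p → ℝ) : Prop :=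
  ∀ b' : Fin p → ℝ,
    1 / (2 * n) * (l2 (Y - X.mulVec b)) ^ 2 + lamn * l1 b ≤
    1 / (2 * n) * (l2 (Y - X.mulVec b')) ^ 2 + lamn * l1 b'

/-- Submatrix of the columns of `X` indexed by `I`. -/
def colSub {n p : ℕ} (X : Matrix (Fin n) (Fin p) ℝ) (I : Finset (Fin p)) :
    Matrix (Fin n) {j // j ∈ I} ℝ :=
  Matrix.of fun i j => X i j.1

/-- The Gram matrix `X_Iᵀ X_I` is invertible. -/
def GramInvertible {n p : ℕ} (X : Matrix (Fin n) (Fin p) ℝ) (I : Finset (Fin p)) : Prop :=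
  IsUnit ((colSub X I)ᵀ * colSub X I).det

/-- The OLS refit of `Y` on the columns of `X` indexed by `I`:
`(X_Iᵀ X_I)⁻¹ X_Iᵀ Y` on `I`, and `0` off `I`. -/
def olsRefit {n p : ℕ} (X : Matrix (Fin n) (Fin p) ℝ) (Y : Fin n → ℝ)
    (I : Finset (Fin p)) : Fin p → ℝ :=
  fun j => if h : j ∈ I then
    (((colSub X I)ᵀ * colSub X I)⁻¹).mulVec ((colSub X I)ᵀ.mulVec Y) ⟨j, h⟩
  else 0


/-- The squared `ℓ₂` norm of a restricted vector is a sum over the restriction set. -/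
lemma l2_restr_sq {p : ℕ} (v : Fin p → ℝ) (T : Finset (Fin p)) :
    (l2 (restr v T)) ^ 2 = ∑ j ∈ T, (v j) ^ 2 := by
  unfold l2 restr
  rw [Real.sq_sqrt (Finset.sum_nonneg fun _ _ => sq_nonneg _)]
  simp [ite_pow]

lemma l2_nonneg {m : ℕ} (v : Fin m → ℝ) : 0 ≤ l2 v := Real.sqrt_nonneg _

/-- Splitting the truncated sum of squares at a truncation level `c`. -/
lemma sum_min_sq_eq {p : ℕ} (β : Fin p → ℝ) {c : ℝ} (hc : 0 ≤ c) :
    ∑ i, min ((β i) ^ 2) (c ^ 2) =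
      ((Finset.univ.filter fun j => c < |β j|).card : ℝ) * c ^ 2 +
        ∑ i ∈ (Finset.univ.filter fun j => c < |β j|)ᶜ, (β i) ^ 2 := by
  rw [← Finset.sum_add_sum_compl (Finset.univ.filter fun j => c < |β j|)]
  congr 1
  · rw [← nsmul_eq_mul, ← Finset.sum_const]
    refine Finset.sum_congr rfl fun i hi => min_eq_right ?_
    have hi' : c < |β i| := by simpa using hi
    rw [← sq_abs (β i)]
    exact pow_le_pow_left₀ hc hi'.le 2
  · refine Finset.sum_congr rfl fun i hi => min_eq_left ?_
    have hi' : |β i| ≤ c := by simpa using hi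
    rw [← sq_abs (β i)]
    exact pow_le_pow_left₀ (abs_nonneg _) hi' 2

/-- If `|β|` is nonincreasing, every index of an entry above the level `c` is smaller than
the number of such entries. -/
lemma val_lt_card_filter_of_lt_abs {p : ℕ} {β : Fin p → ℝ}
    (hmono : ∀ i j : Fin p, i ≤ j → |β j| ≤ |β i|) {c : ℝ} {j : Fin p} (hj : c < |β j|) :
    (j : ℕ) < (Finset.univ.filter fun i => c < |β i|).card := by
  have hsub : Finset.Iic j ⊆ Finset.univ.filter fun i => c < |β i| := fun i hi => by
    simpa using hj.trans_le (hmono i j (by simpa using hi))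
  have hcard := Finset.card_le_card hsub
  rw [Fin.card_Iic] at hcard
  omega

/-- Minkowski's inequality for a constant shift of a vector. -/
lemma sum_add_abs_sq_le {ι : Type*} (s : Finset ι) (f : ι → ℝ) {t a N : ℝ} (ht : 0 ≤ t)
    (hs : (s.card : ℝ) ≤ a) (hN : 0 ≤ N) (hf : ∑ j ∈ s, (f j) ^ 2 = N ^ 2) :
    ∑ j ∈ s, (t + |f j|) ^ 2 ≤ (t * Real.sqrt a + N) ^ 2 := by
  have ha : 0 ≤ a := (Nat.cast_nonneg _).trans hs
  have hsa : Real.sqrt a ^ 2 = a := Real.sq_sqrt ha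
  have hcs : ∑ j ∈ s, |f j| ≤ Real.sqrt a * N := by
    refine abs_le_of_sq_le_sq' ?_ (by positivity) |>.2
    calc (∑ j ∈ s, |f j|) ^ 2 ≤ s.card * ∑ j ∈ s, |f j| ^ 2 := sq_sum_le_card_mul_sum_sq
      _ = s.card * N ^ 2 := by simp only [sq_abs, hf]
      _ ≤ a * N ^ 2 := by gcongr
      _ = (Real.sqrt a * N) ^ 2 := by rw [mul_pow, hsa]
  calc ∑ j ∈ s, (t + |f j|) ^ 2
      = s.card * t ^ 2 + 2 * t * ∑ j ∈ s, |f j| + N ^ 2 := by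
        simp only [add_sq, sq_abs, Finset.sum_add_distrib, hf, Finset.sum_const, nsmul_eq_mul,
          Finset.mul_sum]
    _ ≤ a * t ^ 2 + 2 * t * (Real.sqrt a * N) + N ^ 2 := by gcongr
    _ = (t * Real.sqrt a + N) ^ 2 := by rw [add_sq, mul_pow, hsa]; ring

/-- a deterministic result on the bias of the dropped set. -/
theorem statement_12
    (p n : ℕ) (hp : 2 ≤ p) (hn : 1 ≤ n) (β : Fin p → ℝ)
    (hmono : ∀ i j : Fin p, i ≤ j → |β j| ≤ |β i|)
    (σ lam : ℝ) (hσ : 0 < σ) (hlam : lam = Real.sqrt (2 * Real.log p / n))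
    (s₀ : ℕ) (hess : EssSparsity β lam σ s₀)
    (T₀ : Finset (Fin p)) (hT₀ : T₀ = Finset.univ.filter fun j : Fin p => (j : ℕ) < s₀)
    (A₀ : Finset (Fin p)) (hA₀ : A₀ = Finset.univ.filter fun j => lam * σ < |β j|)
    (a₀ : ℕ) (ha₀ : a₀ = A₀.card)
    (βinit h : Fin p → ℝ) (hh : h = βinit - restr β T₀)
    (t₀ : ℝ) (ht₀ : 0 < t₀)
    (I : Finset (Fin p)) (hI : I = Finset.univ.filter fun j => t₀ ≤ |βinit j|)
    (𝒟 : Finset (Fin p)) (h𝒟 : 𝒟 = Iᶜ)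
    (𝒟₁₁ : Finset (Fin p)) (h𝒟₁₁ : 𝒟₁₁ = 𝒟 ∩ A₀) :
    (l2 (restr β 𝒟)) ^ 2 ≤
      ((s₀ : ℝ) - a₀) * lam ^ 2 * σ ^ 2 +
        (t₀ * Real.sqrt a₀ + l2 (restr h 𝒟₁₁)) ^ 2 ∧
    ∀ (hne : A₀.Nonempty), t₀ < A₀.inf' hne (fun j => |β j|) →
      (l2 (restr β 𝒟)) ^ 2 ≤
        ((s₀ : ℝ) - a₀) * lam ^ 2 * σ ^ 2 +
          (l2 (restr h 𝒟₁₁)) ^ 2 *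
            (A₀.inf' hne (fun j => |β j|) /
              (A₀.inf' hne (fun j => |β j|) - t₀)) ^ 2 := by
  have hlam0 : 0 < lam := by
    have hlog : 0 < Real.log p := Real.log_pos (by exact_mod_cast hp)
    have hn0 : (0 : ℝ) < n := by exact_mod_cast hn
    rw [hlam]
    positivity
  have hc : 0 < lam * σ := mul_pos hlam0 hσ
  have hsum : (a₀ : ℝ) * (lam * σ) ^ 2 + ∑ i ∈ A₀ᶜ, (β i) ^ 2 ≤ s₀ * (lam * σ) ^ 2 := by
    have hmem : ∑ i, min ((β i) ^ 2) (lam ^ 2 * σ ^ 2) ≤ (s₀ : ℝ) * (lam ^ 2 * σ ^ 2) := hess.1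
    rwa [← mul_pow, sum_min_sq_eq β hc.le, ← hA₀, ← ha₀] at hmem
  have ha₀s₀ : a₀ ≤ s₀ := by
    have hnonneg : 0 ≤ ∑ i ∈ A₀ᶜ, (β i) ^ 2 := Finset.sum_nonneg fun _ _ => sq_nonneg _
    have hle : (a₀ : ℝ) * (lam * σ) ^ 2 ≤ s₀ * (lam * σ) ^ 2 := by linarith
    exact_mod_cast le_of_mul_le_mul_right hle (pow_pos hc 2)
  have hA₀T₀ : ∀ j ∈ A₀, j ∈ T₀ := fun j hj => by
    have hj' : lam * σ < |β j| := by simpa [hA₀] using hj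
    have hlt := val_lt_card_filter_of_lt_abs hmono hj'
    rw [← hA₀, ← ha₀] at hlt
    simpa [hT₀] using hlt.trans_le ha₀s₀
  have hβ : ∀ j ∈ 𝒟₁₁, |β j| ≤ t₀ + |h j| := fun j hj => by
    rw [h𝒟₁₁, Finset.mem_inter] at hj
    have hinit : |βinit j| < t₀ := by simpa [h𝒟, hI] using hj.1
    have hhj : β j = βinit j - h j := by
      simp [hh, restr, hA₀T₀ j hj.2]
    rw [hhj]
    linarith [abs_sub (βinit j) (h j)]
  have hsplit : (l2 (restr β 𝒟)) ^ 2 ≤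
      ((s₀ : ℝ) - a₀) * lam ^ 2 * σ ^ 2 + ∑ j ∈ 𝒟₁₁, (β j) ^ 2 := by
    have hsmall : ∑ j ∈ 𝒟 \ A₀, (β j) ^ 2 ≤ ∑ j ∈ A₀ᶜ, (β j) ^ 2 :=
      Finset.sum_le_sum_of_subset_of_nonneg (fun j hj => by simp_all)
        fun _ _ _ => sq_nonneg _
    rw [l2_restr_sq, ← Finset.sum_inter_add_sum_sdiff 𝒟 A₀, ← h𝒟₁₁]
    linarith
  refine ⟨hsplit.trans ?_, fun hne hmin => hsplit.trans ?_⟩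
  · gcongr
    calc ∑ j ∈ 𝒟₁₁, (β j) ^ 2 ≤ ∑ j ∈ 𝒟₁₁, (t₀ + |h j|) ^ 2 :=
          Finset.sum_le_sum fun j hj => by
            rw [← sq_abs (β j)]
            exact pow_le_pow_left₀ (abs_nonneg _) (hβ j hj) 2
      _ ≤ _ := sum_add_abs_sq_le _ _ ht₀.le
          (by rw [ha₀, h𝒟₁₁]; exact_mod_cast Finset.card_le_card Finset.inter_subset_right)
          (l2_nonneg _) (l2_restr_sq _ _).symm
  · gcongr
    rw [l2_restr_sq, Finset.sum_mul]
    refine Finset.sum_le_sum fun j hj => ?_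
    have hjA : j ∈ A₀ := (Finset.mem_inter.1 (h𝒟₁₁ ▸ hj)).2
    have hbj : A₀.inf' hne (fun j => |β j|) ≤ |β j| := Finset.inf'_le _ hjA
    have hβj := hβ j hj
    set b := A₀.inf' hne (fun j => |β j|)
    have hbt : 0 < b - t₀ := sub_pos.2 hmin
    rw [← sq_abs (β j), ← sq_abs (h j), ← mul_pow]
    refine pow_le_pow_left₀ (abs_nonneg _) ?_ 2
    rw [← mul_div_assoc, le_div_iff₀ hbt]
    nlinarith

end ThreshLasso
end
end

section
/- Let X be an n×p real matrix, β ∈ ℝ^p, ε ∈ ℝⁿ, Y = Xβ + ε, let β_init be a Lasso minimizer with penalty λ_n > 0, and suppose ‖Xᵀε/n‖_∞ ≤ λ_n/2. Let T₀ ⊆ {1,…,p}, β₀ = β_{T₀}, h = β_init − β₀, δ = β_init − β. Suppose additionally that λ_n·‖h_{T₀}‖₁ ≤ ‖Xδ‖₂²/n + ‖Xh‖₂²/n ≤ ‖X(β − β₀)‖₂²/n. Then λ_n·‖h_{T₀^c}‖₁ ≤ 3·‖X(β − β₀)‖₂²/n and λ_n·‖h‖₁ ≤ 4·‖X(β − β₀)‖₂²/n.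 -/
open Finset Matrix Real
open scoped BigOperators Classical

noncomputable section

namespace ThreshLasso

theorem l2_sq {m : ℕ} (v : Fin m → ℝ) : l2 v ^ 2 = ∑ i, v i ^ 2 :=
  Real.sq_sqrt (Finset.sum_nonneg fun i _ => sq_nonneg (v i))

theorem l2_sq_add_smul {m : ℕ} (r u : Fin m → ℝ) (t : ℝ) :
    l2 (r + t • u) ^ 2 = l2 r ^ 2 + 2 * t * (r ⬝ᵥ u) + t ^ 2 * l2 u ^ 2 := by
  simp only [l2_sq, dotProduct, Finset.mul_sum, ← Finset.sum_add_distrib]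
  refine Finset.sum_congr rfl fun i _ => ?_
  simp only [Pi.add_apply, Pi.smul_apply, smul_eq_mul]
  ring

theorem l1_restr_add_l1_restr_compl {p : ℕ} (v : Fin p → ℝ) (T : Finset (Fin p)) :
    l1 (restr v T) + l1 (restr v Tᶜ) = l1 v := by
  simp only [l1, restr, ← Finset.sum_add_distrib]
  refine Finset.sum_congr rfl fun i _ => ?_
  by_cases hi : i ∈ T <;> simp [hi]

/-- Convexity of the ℓ₁ norm along the segment from `b` to `c`. -/
theorem l1_sub_smul_le {p : ℕ} (b c : Fin p → ℝ) {t : ℝ} (ht0 : 0 ≤ t) (ht1 : t ≤ 1) :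
    l1 (b - t • (b - c)) ≤ l1 b + t * (l1 c - l1 b) := by
  have key : l1 (b - t • (b - c)) ≤ ∑ i, ((1 - t) * |b i| + t * |c i|) := by
    refine Finset.sum_le_sum fun i _ => ?_
    calc |(b - t • (b - c)) i| = |(1 - t) * b i + t * c i| := by
          congr 1
          simp only [Pi.sub_apply, Pi.smul_apply, smul_eq_mul]
          ring
      _ ≤ |(1 - t) * b i| + |t * c i| := abs_add_le _ _
      _ = (1 - t) * |b i| + t * |c i| := by
          rw [abs_mul, abs_mul, abs_of_nonneg (sub_nonneg.2 ht1), abs_of_nonneg ht0]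
  rw [Finset.sum_add_distrib, ← Finset.mul_sum, ← Finset.mul_sum] at key
  unfold l1 at *
  linarith

/-- If `β₀` vanishes off `T`, then `‖b‖₁ - ‖β₀‖₁` dominates
`‖(b - β₀)_{Tᶜ}‖₁ - ‖(b - β₀)_T‖₁`. -/
theorem l1_restr_compl_sub_le {p : ℕ} (b β : Fin p → ℝ) (T : Finset (Fin p)) :
    l1 (restr (b - restr β T) Tᶜ) - l1 (restr (b - restr β T) T) ≤
      l1 b - l1 (restr β T) := by
  simp only [l1, ← Finset.sum_sub_distrib]
  refine Finset.sum_le_sum fun i _ => ?_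
  by_cases hi : i ∈ T
  · simp only [restr, Finset.mem_compl, hi, not_true_eq_false, if_true, if_false, Pi.sub_apply,
      abs_zero]
    have := abs_sub_abs_le_abs_sub (β i) (b i)
    rw [abs_sub_comm] at this
    linarith
  · simp [restr, hi]

theorem nonneg_of_forall_quadratic_nonneg {c q : ℝ} (hq : 0 ≤ q)
    (H : ∀ t : ℝ, 0 < t → t ≤ 1 → 0 ≤ t * c + t ^ 2 * q) : 0 ≤ c := by
  by_contra! hc
  have hd : 0 < q - c := by linarith
  have h := H (-c / (q - c)) (div_pos (by linarith) hd) ((div_le_one hd).2 (by linarith))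
  have e : -c / (q - c) * c + (-c / (q - c)) ^ 2 * q = c ^ 3 / (q - c) ^ 2 := by
    field_simp
    ring
  rw [e] at h
  have : c ^ 3 / (q - c) ^ 2 < 0 :=
    div_neg_of_neg_of_pos (by nlinarith [mul_pos_of_neg_of_neg hc hc]) (by positivity)
  linarith

/-- First-order optimality of a Lasso minimizer `b` in the direction of a competitor `c`. -/
theorem IsLassoSol.variational {n p : ℕ} {X : Matrix (Fin n) (Fin p) ℝ} {Y : Fin n → ℝ}
    {lamn : ℝ} {b : Fin p → ℝ} (hlamn : 0 ≤ lamn) (hb : IsLassoSol X Y lamn b)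
    (c : Fin p → ℝ) :
    lamn * (l1 b - l1 c) ≤ ((Y - X.mulVec b) ⬝ᵥ X.mulVec (b - c)) / n := by
  suffices 0 ≤ ((Y - X.mulVec b) ⬝ᵥ X.mulVec (b - c)) / n + lamn * (l1 c - l1 b) by linarith
  refine nonneg_of_forall_quadratic_nonneg
    (q := 1 / (2 * n) * l2 (X.mulVec (b - c)) ^ 2) (by positivity) fun t ht0 ht1 => ?_
  have h := hb (b - t • (b - c))
  have e : Y - X.mulVec (b - t • (b - c)) = (Y - X.mulVec b) + t • X.mulVec (b - c) := by
    rw [Matrix.mulVec_sub X b (t • (b - c)), Matrix.mulVec_smul]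
    abel
  rw [e, l2_sq_add_smul] at h
  have h1 := mul_le_mul_of_nonneg_left (l1_sub_smul_le b c ht0.le ht1) hlamn
  have e2 : ∀ s : ℝ, 1 / (2 * (n : ℝ)) * (2 * t * s) = t * (s / n) := fun s => by
    rw [one_div, mul_inv]
    ring
  have e3 := e2 ((Y - X.mulVec b) ⬝ᵥ X.mulVec (b - c))
  linarith

theorem dotProduct_mulVec_div_le {n p : ℕ} (X : Matrix (Fin n) (Fin p) ℝ) (ε : Fin n → ℝ)
    {K : ℝ} (hK : ∀ j, |(∑ i, X i j * ε i) / n| ≤ K) (v : Fin p → ℝ) :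
    (ε ⬝ᵥ X.mulVec v) / n ≤ K * l1 v := by
  have e : (ε ⬝ᵥ X.mulVec v) / n = ∑ j, (∑ i, X i j * ε i) / n * v j := by
    simp only [dotProduct, Matrix.mulVec, Finset.mul_sum, Finset.sum_div, Finset.sum_mul]
    rw [Finset.sum_comm]
    refine Finset.sum_congr rfl fun j _ => Finset.sum_congr rfl fun i _ => ?_
    ring
  rw [e, l1, Finset.mul_sum]
  refine Finset.sum_le_sum fun j _ => (le_abs_self _).trans ?_
  rw [abs_mul]
  exact mul_le_mul_of_nonneg_right (hK j) (abs_nonneg _)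

/-- Case 3 of the Lasso analysis: ℓ₁ bounds without cone
membership. -/
theorem statement_18
    (n p : ℕ) (hn : 0 < n)
    (X : Matrix (Fin n) (Fin p) ℝ) (β : Fin p → ℝ) (ε Y : Fin n → ℝ)
    (hY : Y = X.mulVec β + ε)
    (lamn : ℝ) (hlamn : 0 < lamn)
    (βinit : Fin p → ℝ) (hinit : IsLassoSol X Y lamn βinit)
    (hnoise : ∀ j, |(∑ i, X i j * ε i) / n| ≤ lamn / 2)
    (T₀ : Finset (Fin p))
    (β₀ h δ : Fin p → ℝ) (hβ₀ : β₀ = restr β T₀)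
    (hh : h = βinit - β₀) (hδ : δ = βinit - β)
    (hlow : lamn * l1 (restr h T₀) ≤
      (l2 (X.mulVec δ)) ^ 2 / n + (l2 (X.mulVec h)) ^ 2 / n)
    (hhigh : (l2 (X.mulVec δ)) ^ 2 / n + (l2 (X.mulVec h)) ^ 2 / n ≤
      (l2 (X.mulVec (β - β₀))) ^ 2 / n) :
    lamn * l1 (restr h T₀ᶜ) ≤ 3 * ((l2 (X.mulVec (β - β₀))) ^ 2 / n) ∧
    lamn * l1 h ≤ 4 * ((l2 (X.mulVec (β - β₀))) ^ 2 / n) := by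
  have hvar := hinit.variational hlamn.le β₀
  rw [← hh] at hvar
  have hres : Y - X.mulVec βinit = ε - X.mulVec δ := by
    rw [hY, hδ, Matrix.mulVec_sub]
    abel
  have hdiff : X.mulVec (β - β₀) = X.mulVec h + (-1 : ℝ) • X.mulVec δ := by
    rw [hh, hδ, Matrix.mulVec_sub, Matrix.mulVec_sub, Matrix.mulVec_sub]
    module
  have hpol := l2_sq_add_smul (X.mulVec h) (X.mulVec δ) (-1)
  rw [← hdiff, dotProduct_comm] at hpol
  have hpol' : l2 (X.mulVec (β - β₀)) ^ 2 / n = l2 (X.mulVec h) ^ 2 / n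
      - 2 * ((X.mulVec δ ⬝ᵥ X.mulVec h) / n) + l2 (X.mulVec δ) ^ 2 / n := by
    rw [hpol]
    ring
  rw [hres, sub_dotProduct, sub_div] at hvar
  have hcorr := dotProduct_mulVec_div_le X ε hnoise h
  have hsplit := congrArg (lamn * ·) (l1_restr_add_l1_restr_compl h T₀)
  have hcone := l1_restr_compl_sub_le βinit β T₀
  rw [← hβ₀, ← hh] at hcone
  have hcone' := mul_le_mul_of_nonneg_left hcone hlamn.le
  simp only [mul_add] at hsplit
  constructor <;> linarith

end ThreshLasso
end
end
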